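/- For all a, y > 0 the limit ψ^G(a,y) := lim_{n→∞} (1/(2n)) log P^G_{2n}(a,y) exists, and ψ^G(a,y) = log 2 if a ≤ 2 and y ≤ 1; ψ^G(a,y) = (1/2)log 2 + (1/2)log a − (1/4)log(a−1) if a > 2 and y ≤ 1; ψ^G(a,y) = (1/2)log 2 + (1/2)log(y+1) − (1/4)log y if a ≤ 2 and y > 1; and ψ^G(a,y) = (1/2)log a − (1/4)log(a−1) + (1/2)log(y+1) − (1/4)log y if a > 2 and y > 1. -/

import Mathlib

open Finset Filter

attribute [local instance] Classical.propDecidable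

/-- Height (second coordinate) of a binomial path after `i` steps, starting at height `c`;
steps are encoded by `s : Fin n → Bool` (`true` = up step `(1,1)`, `false` = down step `(1,-1)`).
The path visits the points `(x₀ + i, hgt c s i)` for `0 ≤ i ≤ n`. -/
def hgt {n : ℕ} (c : ℤ) (s : Fin n → Bool) (i : ℕ) : ℤ :=
  c + ∑ j ∈ Finset.range i, (if h : j < n then (if s ⟨j, h⟩ then (1 : ℤ) else -1) else 0)

/-- The path lies in the upper half-plane (all second coordinates ≥ 0). -/
def InUHP {n : ℕ} (c : ℤ) (s : Fin n → Bool) : Prop :=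
  ∀ i ≤ n, 0 ≤ hgt c s i

/-- The number of vertices of the path with second coordinate 0. -/
def visits {n : ℕ} (c : ℤ) (s : Fin n → Bool) : ℕ :=
  ((Finset.range (n + 1)).filter (fun i => hgt c s i = 0)).card

/-- `(c, sp, sm)` encodes a staircase polygon of length `2n` in `𝒫^S_{2n}`:
both binomial paths of length `n` start at `(0, c)` (so the leftmost vertex has first
coordinate `0`), they end at the same point, the upper path `sp` is strictly above the
lower path `sm` at the intermediate points, the polygon lies in the upper half-plane,
and it has at least one vertex with second coordinate `0`. -/
def IsStaircase {n : ℕ} (c : ℤ) (sp sm : Fin n → Bool) : Prop :=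
  hgt c sp n = hgt c sm n ∧
  (∀ i, 0 < i → i < n → hgt c sm i < hgt c sp i) ∧
  InUHP c sp ∧ InUHP c sm ∧
  (∃ i ≤ n, hgt c sp i = 0 ∨ hgt c sm i = 0)

/-- `P^G_{2n}(a,y)`: partition function of grafted staircase polygons of length `2n`,
i.e. those whose leftmost vertex has second coordinate `1` and whose rightmost vertex
has second coordinate `1` if `n` is even and `2` if `n` is odd. -/
noncomputable def PG (n : ℕ) (a y : ℝ) : ℝ :=
  ∑ p ∈ (Finset.univ : Finset (Fin (n + 1) × (Fin n → Bool) × (Fin n → Bool))).filter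
      (fun p => IsStaircase ((p.1 : ℕ) : ℤ) p.2.1 p.2.2 ∧ ((p.1 : ℕ) : ℤ) = 1 ∧
        hgt ((p.1 : ℕ) : ℤ) p.2.1 n = (if n % 2 = 0 then 1 else 2)),
    a ^ visits ((p.1 : ℕ) : ℤ) p.2.2 * y ^ hgt ((p.1 : ℕ) : ℤ) p.2.1 (n / 2)


/-- one-site weight of a pair of heights -/
noncomputable def kap (a : ℝ) (p q : ℤ) : ℝ :=
  if 0 ≤ q ∧ q < p then (if q = 0 then a else 1) else 0

/-- transfer operator on functions of a pair of heights -/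
noncomputable def TT (a : ℝ) (f : ℤ → ℤ → ℝ) : ℤ → ℤ → ℝ := fun p q =>
  kap a (p+1) (q+1) * f (p+1) (q+1) + kap a (p+1) (q-1) * f (p+1) (q-1)
  + kap a (p-1) (q+1) * f (p-1) (q+1) + kap a (p-1) (q-1) * f (p-1) (q-1)

/-- sum over pairs of step sequences of a product of local weights -/
noncomputable def QQ (φ : ℕ → ℤ → ℤ → ℝ) (n : ℕ) (p q : ℤ) : ℝ :=
  ∑ sp : Fin n → Bool, ∑ sm : Fin n → Bool,
    ∏ i ∈ Finset.range n, φ i (hgt p sp (i+1)) (hgt q sm (i+1))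

lemma hgt_zero {n : ℕ} (c : ℤ) (s : Fin n → Bool) : hgt c s 0 = c := by simp [hgt]

lemma hgt_cons {n : ℕ} (c : ℤ) (b : Bool) (s : Fin n → Bool) (i : ℕ) :
    hgt c (Fin.cons b s : Fin (n+1) → Bool) (i+1) = hgt (c + if b then 1 else -1) s i := by
  unfold hgt
  rw [Finset.sum_range_succ']
  have : ∀ j ∈ Finset.range i, (if h : j + 1 < n + 1 then
      (if (Fin.cons b s : Fin (n+1) → Bool) ⟨j+1, h⟩ then (1:ℤ) else -1) else 0)
      = (if h : j < n then (if s ⟨j, h⟩ then (1 : ℤ) else -1) else 0) := by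
    intro j _
    by_cases h : j < n
    · have h' : j + 1 < n + 1 := by omega
      rw [dif_pos h, dif_pos h']
      have : (⟨j+1, h'⟩ : Fin (n+1)) = Fin.succ ⟨j, h⟩ := rfl
      rw [this, Fin.cons_succ]
    · have h' : ¬ j + 1 < n + 1 := by omega
      rw [dif_neg h, dif_neg h']
  rw [Finset.sum_congr rfl this]
  have h0 : (if h : 0 < n + 1 then
      (if (Fin.cons b s : Fin (n+1) → Bool) ⟨0, h⟩ then (1:ℤ) else -1) else 0)
      = if b then 1 else -1 := by
    rw [dif_pos (Nat.succ_pos n)]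
    have : (⟨0, Nat.succ_pos n⟩ : Fin (n+1)) = 0 := rfl
    rw [this, Fin.cons_zero]
  rw [h0]; ring

lemma sum_cons {n : ℕ} (F : (Fin (n+1) → Bool) → ℝ) :
    ∑ s, F s = ∑ s : Fin n → Bool, F (Fin.cons true s) + ∑ s : Fin n → Bool, F (Fin.cons false s) := by
  rw [← (Fin.consEquiv (fun _ : Fin (n+1) => Bool)).sum_comp, Fintype.sum_prod_type]
  simp [Fin.consEquiv]

lemma QQ_zero (φ : ℕ → ℤ → ℤ → ℝ) (p q : ℤ) : QQ φ 0 p q = 1 := by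
  simp [QQ]

lemma QQ_succ (φ : ℕ → ℤ → ℤ → ℝ) (n : ℕ) (p q : ℤ) :
    QQ φ (n+1) p q =
      φ 0 (p+1) (q+1) * QQ (fun i => φ (i+1)) n (p+1) (q+1)
    + φ 0 (p+1) (q-1) * QQ (fun i => φ (i+1)) n (p+1) (q-1)
    + φ 0 (p-1) (q+1) * QQ (fun i => φ (i+1)) n (p-1) (q+1)
    + φ 0 (p-1) (q-1) * QQ (fun i => φ (i+1)) n (p-1) (q-1) := by
  unfold QQ
  rw [sum_cons]
  simp_rw [sum_cons, Finset.prod_range_succ', hgt_cons, hgt_zero, Finset.mul_sum,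
    Finset.sum_add_distrib]
  simp only [if_true, Bool.false_eq_true, if_false, ← sub_eq_add_neg]
  simp only [mul_comm]
  ring

lemma QQ_iter (a : ℝ) (k : ℕ) : ∀ (φ : ℕ → ℤ → ℤ → ℝ) (n : ℕ) (_ : ∀ i < k, φ i = kap a),
    QQ φ (k+n) = (TT a)^[k] (QQ (fun i => φ (i+k)) n) := by
  induction k with
  | zero => intro φ n _; simp
  | succ k ih =>
    intro φ n h
    rw [Function.iterate_succ_apply', show k + 1 + n = (k+n)+1 by ring]
    have := ih (fun i => φ (i+1)) n (fun i hi => h (i+1) (by omega))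
    funext p q
    rw [QQ_succ, this, h 0 (by omega)]
    simp only [TT]
    have e : (fun i => φ (i + k + 1)) = (fun i => φ (i + (k+1))) := by
      funext i; rw [add_assoc]
    rw [e]

/-- target height -/
def eH (n : ℕ) : ℤ := if n % 2 = 0 then 1 else 2

/-- local weights -/
noncomputable def phi (a y : ℝ) (n m : ℕ) (i : ℕ) (p q : ℤ) : ℝ :=
  if i + 1 = n then (if p = eH n ∧ q = eH n then 1 else 0)
  else kap a p q * (if i + 1 = m then y ^ p else 1)

lemma prod_kap (a : ℝ) (k : ℕ) (P Q : ℕ → ℤ) :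
    ∏ i ∈ Finset.range k, kap a (P i) (Q i) =
      if (∀ i < k, 0 ≤ Q i ∧ Q i < P i) then
        a ^ (∑ i ∈ Finset.range k, if Q i = 0 then 1 else 0) else 0 := by
  split_ifs with h
  · rw [← Finset.prod_pow_eq_pow_sum]
    refine Finset.prod_congr rfl fun i hi => ?_
    rw [Finset.mem_range] at hi
    unfold kap
    rw [if_pos (h i hi)]
    split_ifs <;> simp
  · push Not at h
    obtain ⟨i, hi, h⟩ := h
    refine Finset.prod_eq_zero (Finset.mem_range.2 hi) ?_
    unfold kap
    rw [if_neg]; rintro ⟨h1, h2⟩; have := h h1; omega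

lemma summand_eq (a y : ℝ) (k m : ℕ) (hk : 1 ≤ k) (hm : 1 ≤ m) (hmk : m ≤ k)
    (sp sm : Fin (k+1) → Bool) :
    (if IsStaircase 1 sp sm ∧ hgt 1 sp (k+1) = eH (k+1) then
      a ^ visits 1 sm * y ^ hgt 1 sp m else 0) =
    ∏ i ∈ Finset.range (k+1), phi a y (k+1) m i (hgt 1 sp (i+1)) (hgt 1 sm (i+1)) := by
  have he : 1 ≤ eH (k+1) := by unfold eH; split_ifs <;> norm_num
  rw [Finset.prod_range_succ]
  have h1 : ∀ i ∈ Finset.range k, phi a y (k+1) m i (hgt 1 sp (i+1)) (hgt 1 sm (i+1)) =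
      kap a (hgt 1 sp (i+1)) (hgt 1 sm (i+1)) *
        (if i = m - 1 then y ^ (hgt 1 sp (i+1)) else 1) := by
    intro i hi
    rw [Finset.mem_range] at hi
    unfold phi
    rw [if_neg (by omega)]
    congr 1
    by_cases h : i + 1 = m
    · rw [if_pos h, if_pos (by omega)]
    · rw [if_neg h, if_neg (by omega)]
  rw [Finset.prod_congr rfl h1, Finset.prod_mul_distrib, Finset.prod_ite_eq',
    if_pos (Finset.mem_range.2 (by omega)), prod_kap]
  have hm1 : m - 1 + 1 = m := by omega
  rw [hm1]
  have hphi : phi a y (k+1) m k (hgt 1 sp (k+1)) (hgt 1 sm (k+1)) =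
    if hgt 1 sp (k+1) = eH (k+1) ∧ hgt 1 sm (k+1) = eH (k+1) then 1 else 0 := by
    unfold phi; rw [if_pos rfl]
  rw [hphi]
  have step : ∀ s : Fin (k+1) → Bool, hgt 1 s 1 = 2 ∨ hgt 1 s 1 = 0 := by
    intro s
    unfold hgt
    simp only [Finset.sum_range_one, Nat.succ_pos, dif_pos]
    split_ifs <;> simp
  have hiff : (IsStaircase 1 sp sm ∧ hgt 1 sp (k+1) = eH (k+1)) ↔
     ((∀ i < k, 0 ≤ hgt 1 sm (i+1) ∧ hgt 1 sm (i+1) < hgt 1 sp (i+1)) ∧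
      (hgt 1 sp (k+1) = eH (k+1) ∧ hgt 1 sm (k+1) = eH (k+1))) := by
    constructor
    · rintro ⟨⟨h1, h2, h3, h4, h5⟩, h6⟩
      exact ⟨fun i hi => ⟨h4 _ (by omega), h2 _ (by omega) (by omega)⟩, h6, by omega⟩
    · rintro ⟨h1, h2, h3⟩
      have hq : InUHP 1 sm := by
        intro i hi
        rcases Nat.eq_zero_or_pos i with h | h
        · subst h; rw [hgt_zero]; norm_num
        · rcases eq_or_lt_of_le hi with h' | h'
          · rw [h']; omega
          · have := (h1 (i-1) (by omega)).1
            rwa [show i - 1 + 1 = i by omega] at this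
      have hlt : ∀ i, 0 < i → i < k+1 → hgt 1 sm i < hgt 1 sp i := by
        intro i h h'
        have := (h1 (i-1) (by omega)).2
        rwa [show i - 1 + 1 = i by omega] at this
      refine ⟨⟨by omega, hlt, ?_, hq, 1, by omega, ?_⟩, h2⟩
      · intro i hi
        rcases Nat.eq_zero_or_pos i with h | h
        · subst h; rw [hgt_zero]; norm_num
        · rcases eq_or_lt_of_le hi with h' | h'
          · rw [h']; omega
          · have := hlt i h h'
            have := hq i hi
            omega
      · have := hlt 1 (by omega) (by omega)
        have := step sp
        have := step sm
        omega
  by_cases hc : IsStaircase 1 sp sm ∧ hgt 1 sp (k+1) = eH (k+1)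
  · rw [if_pos hc]
    obtain ⟨h1, h2⟩ := hiff.1 hc
    rw [if_pos h1, if_pos h2, mul_one]
    congr 2
    unfold visits
    rw [Finset.card_filter, Finset.sum_range_succ, Finset.sum_range_succ', hgt_zero,
      if_neg (show ¬ hgt 1 sm (k+1) = 0 by omega)]
    simp
  · rw [if_neg hc]
    rw [hiff] at hc
    by_cases h1 : (∀ i < k, 0 ≤ hgt 1 sm (i+1) ∧ hgt 1 sm (i+1) < hgt 1 sp (i+1))
    · rw [if_neg (fun h2 => hc ⟨h1, h2⟩)]; simp
    · rw [if_neg h1]; simp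

lemma PG_eq_QQ (a y : ℝ) (k : ℕ) (hk : 1 ≤ k) :
    PG (k+1) a y = QQ (phi a y (k+1) ((k+1)/2)) (k+1) 1 1 := by
  unfold PG QQ
  rw [Finset.sum_filter, Fintype.sum_prod_type]
  rw [Finset.sum_eq_single (⟨1, by omega⟩ : Fin (k+1+1))]
  · rw [Fintype.sum_prod_type]
    refine Finset.sum_congr rfl fun sp _ => Finset.sum_congr rfl fun sm _ => ?_
    rw [← summand_eq a y k ((k+1)/2) hk (by omega) (by omega) sp sm]
    simp [eH]
    congr
  · intro b _ hb
    refine Finset.sum_eq_zero fun x _ => ?_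
    rw [if_neg]
    rintro ⟨_, h, _⟩
    apply hb
    ext
    simpa using h
  · simp

/-- delta function -/
noncomputable def dlt (p₀ q₀ : ℤ) : ℤ → ℤ → ℝ := fun p q => if p = p₀ ∧ q = q₀ then 1 else 0

lemma TT_congr (a : ℝ) (f g : ℤ → ℤ → ℝ) (h : ∀ p q, 0 ≤ q → q < p → f p q = g p q) :
    TT a f = TT a g := by
  have : ∀ p q, kap a p q * f p q = kap a p q * g p q := by
    intro p q
    unfold kap
    split_ifs with h1 h2 <;> simp <;> simp_all
  funext p q
  simp only [TT, this]

lemma PG_eq (a y : ℝ) (m j : ℕ) (hj : 1 ≤ j) (hmj : j = m ∨ j = m + 1) :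
    PG (m+1+(j+1)) a y =
      (TT a)^[m+1] (fun p q => y ^ p * (TT a)^[j]
        (dlt (eH (m+1+(j+1)) + 1) (eH (m+1+(j+1)) - 1)) p q) 1 1 := by
  have e1 : m+1+(j+1) = (m+1+j)+1 := by ring
  have e2 : (m+1+j+1)/2 = m+1 := by omega
  rw [show m+1+(j+1) = (m+1+j)+1 by ring, PG_eq_QQ a y (m+1+j) (by omega), e2]
  set n := m+1+j+1 with hn
  rw [show n = m + ((j+1)+1) by omega, QQ_iter a m]
  swap
  · intro i hi
    funext p q
    unfold phi
    rw [if_neg (by omega), if_neg (by omega), mul_one]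
  rw [Function.iterate_succ_apply]
  refine congrFun (congrFun (congrArg _ ?_) 1) 1
  funext p q
  rw [QQ_succ, QQ_iter a j]
  swap
  · intro i hi
    funext p q
    unfold phi
    rw [if_neg (by omega), if_neg (by omega), mul_one]
  have key : (TT a)^[j] (QQ (fun i => phi a y (m + (j+1+1)) (m+1) (i + j + 1 + m)) 1) =
      (TT a)^[j] (dlt (eH (m + (j+1+1)) + 1) (eH (m + (j+1+1)) - 1)) := by
    obtain ⟨j', rfl⟩ : ∃ j', j = j' + 1 := ⟨j - 1, by omega⟩
    rw [Function.iterate_succ_apply, Function.iterate_succ_apply]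
    congr 1
    refine TT_congr a _ _ fun p q h0 h1 => ?_
    rw [QQ_succ]
    have hlast : ∀ p q, phi a y (m + (j'+1+1+1)) (m+1) (0 + (j'+1) + 1 + m) p q =
        if p = eH (m + (j'+1+1+1)) ∧ q = eH (m + (j'+1+1+1)) then 1 else 0 := by
      intro p q
      unfold phi
      rw [if_pos (by omega)]
    simp only [QQ_zero, hlast, dlt]
    generalize eH (m + (j'+1+1+1)) = e
    by_cases h : p = e + 1 ∧ q = e - 1
    · rw [if_pos h, if_neg (by omega), if_neg (by omega), if_pos (by omega), if_neg (by omega)]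
      norm_num
    · rw [if_neg h, if_neg (by omega), if_neg (by omega), if_neg (by omega), if_neg (by omega)]
      norm_num
  rw [key]
  have hph : ∀ p q, phi a y (m + (j+1+1)) (m+1) (0+m) p q = kap a p q * y ^ p := by
    intro p q
    unfold phi
    rw [if_neg (by omega), if_pos (by omega)]
  simp only [hph, TT]
  ring

lemma TT_apply (a : ℝ) (f : ℤ → ℤ → ℝ) (p q : ℤ) : TT a f p q =
  kap a (p+1) (q+1) * f (p+1) (q+1) + kap a (p+1) (q-1) * f (p+1) (q-1)
  + kap a (p-1) (q+1) * f (p-1) (q+1) + kap a (p-1) (q-1) * f (p-1) (q-1) := rfl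

lemma kap_nonneg {a : ℝ} (ha : 0 < a) (p q : ℤ) : 0 ≤ kap a p q := by
  unfold kap; split_ifs <;> linarith

lemma kap_le {a : ℝ} (p q : ℤ) : kap a p q ≤ max 1 a := by
  unfold kap; split_ifs <;> simp

lemma kap_ge {a : ℝ} (p q : ℤ) (h : kap a p q ≠ 0) : min 1 a ≤ kap a p q := by
  unfold kap at *; split_ifs at * <;> simp_all

lemma TT_nonneg {a : ℝ} (ha : 0 < a) {f : ℤ → ℤ → ℝ} (hf : ∀ p q, 0 ≤ f p q) (p q : ℤ) :
    0 ≤ TT a f p q := by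
  have := fun p q => mul_nonneg (kap_nonneg ha p q) (hf p q)
  unfold TT
  linarith [this (p+1) (q+1), this (p+1) (q-1), this (p-1) (q+1), this (p-1) (q-1)]

lemma TT_iter_nonneg {a : ℝ} (ha : 0 < a) {f : ℤ → ℤ → ℝ} (hf : ∀ p q, 0 ≤ f p q) (k : ℕ) :
    ∀ p q, 0 ≤ (TT a)^[k] f p q := by
  induction k with
  | zero => simpa using hf
  | succ k ih => rw [Function.iterate_succ_apply']; exact TT_nonneg ha ih

lemma TT_mono {a : ℝ} (ha : 0 < a) {f g : ℤ → ℤ → ℝ}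
    (h : ∀ p q, 0 ≤ q → q ≤ p → f p q ≤ g p q) (p q : ℤ) : TT a f p q ≤ TT a g p q := by
  have : ∀ p q, kap a p q * f p q ≤ kap a p q * g p q := by
    intro p q
    by_cases h1 : 0 ≤ q ∧ q < p
    · exact mul_le_mul_of_nonneg_left (h p q h1.1 h1.2.le) (kap_nonneg ha p q)
    · simp [kap, h1]
  unfold TT
  linarith [this (p+1) (q+1), this (p+1) (q-1), this (p-1) (q+1), this (p-1) (q-1)]

lemma TT_iter_mono {a : ℝ} (ha : 0 < a) {f g : ℤ → ℤ → ℝ}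
    (h : ∀ p q, 0 ≤ q → q ≤ p → f p q ≤ g p q) (k : ℕ) :
    ∀ p q, 0 ≤ q → q ≤ p → (TT a)^[k] f p q ≤ (TT a)^[k] g p q := by
  induction k with
  | zero => simpa using h
  | succ k ih =>
    rw [Function.iterate_succ_apply', Function.iterate_succ_apply']
    intro p q _ _
    exact TT_mono ha ih p q

lemma TT_smul (a c : ℝ) (f : ℤ → ℤ → ℝ) :
    TT a (fun p q => c * f p q) = fun p q => c * TT a f p q := by
  funext p q; simp only [TT]; ring

lemma TT_iter_smul (a c : ℝ) (f : ℤ → ℤ → ℝ) (k : ℕ) :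
    (TT a)^[k] (fun p q => c * f p q) = fun p q => c * (TT a)^[k] f p q := by
  induction k with
  | zero => rfl
  | succ k ih =>
    rw [Function.iterate_succ_apply', Function.iterate_succ_apply', ih, TT_smul]

lemma TT_iter_lin (a c : ℝ) (f1 f2 f3 f4 : ℤ → ℤ → ℝ) (k : ℕ) :
    (TT a)^[k] (fun p q => c * (f1 p q + f2 p q + f3 p q + f4 p q)) = fun p q =>
      c * ((TT a)^[k] f1 p q + (TT a)^[k] f2 p q + (TT a)^[k] f3 p q + (TT a)^[k] f4 p q) := by
  induction k with
  | zero => rfl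
  | succ k ih =>
    simp only [Function.iterate_succ_apply', ih]
    funext p q; simp only [TT]; ring

/-- iterated kernel -/
noncomputable def KK (a : ℝ) (k : ℕ) (p q p₀ q₀ : ℤ) : ℝ := (TT a)^[k] (dlt p₀ q₀) p q

lemma dlt_nonneg (p₀ q₀ p q : ℤ) : 0 ≤ dlt p₀ q₀ p q := by
  unfold dlt; split_ifs <;> norm_num

lemma KK_nonneg {a : ℝ} (ha : 0 < a) (k : ℕ) (p q p₀ q₀ : ℤ) : 0 ≤ KK a k p q p₀ q₀ :=
  TT_iter_nonneg ha (dlt_nonneg p₀ q₀) k p q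

lemma KK_zero (a : ℝ) (p q p₀ q₀ : ℤ) :
    KK a 0 p q p₀ q₀ = if p = p₀ ∧ q = q₀ then 1 else 0 := rfl

lemma KK_first (a : ℝ) (k : ℕ) (p q p₀ q₀ : ℤ) : KK a (k+1) p q p₀ q₀ =
    kap a (p+1) (q+1) * KK a k (p+1) (q+1) p₀ q₀ + kap a (p+1) (q-1) * KK a k (p+1) (q-1) p₀ q₀
  + kap a (p-1) (q+1) * KK a k (p-1) (q+1) p₀ q₀ + kap a (p-1) (q-1) * KK a k (p-1) (q-1) p₀ q₀ := by
  unfold KK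
  rw [Function.iterate_succ_apply']; rfl

lemma kap_dlt (a : ℝ) (p q p₀ q₀ s t : ℤ) :
    kap a (p+s) (q+t) * dlt p₀ q₀ (p+s) (q+t) = kap a p₀ q₀ * dlt (p₀ - s) (q₀ - t) p q := by
  unfold dlt
  by_cases h : p + s = p₀ ∧ q + t = q₀
  · rw [if_pos h, if_pos (by omega), h.1, h.2]
  · rw [if_neg h, if_neg (by omega)]; simp

lemma KK_last (a : ℝ) (k : ℕ) (p q p₀ q₀ : ℤ) : KK a (k+1) p q p₀ q₀ =
    kap a p₀ q₀ * (KK a k p q (p₀-1) (q₀-1) + KK a k p q (p₀-1) (q₀+1)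
      + KK a k p q (p₀+1) (q₀-1) + KK a k p q (p₀+1) (q₀+1)) := by
  unfold KK
  rw [Function.iterate_succ_apply]
  have : TT a (dlt p₀ q₀) = fun p q => kap a p₀ q₀ * (dlt (p₀-1) (q₀-1) p q +
      dlt (p₀-1) (q₀+1) p q + dlt (p₀+1) (q₀-1) p q + dlt (p₀+1) (q₀+1) p q) := by
    funext p q
    unfold TT
    have h1 := kap_dlt a p q p₀ q₀ 1 1
    have h2 := kap_dlt a p q p₀ q₀ 1 (-1)
    have h3 := kap_dlt a p q p₀ q₀ (-1) 1
    have h4 := kap_dlt a p q p₀ q₀ (-1) (-1)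
    simp only [sub_neg_eq_add, ← sub_eq_add_neg] at h1 h2 h3 h4
    rw [h1, h2, h3, h4]; ring
  rw [this, TT_iter_lin]

lemma KK_rev (a : ℝ) (k : ℕ) : ∀ p q p₀ q₀ : ℤ,
    kap a p q * KK a k p q p₀ q₀ = kap a p₀ q₀ * KK a k p₀ q₀ p q := by
  induction k with
  | zero =>
    intro p q p₀ q₀
    rw [KK_zero, KK_zero]
    by_cases h : p = p₀ ∧ q = q₀
    · rw [h.1, h.2]
    · rw [if_neg h, if_neg (by omega)]; simp
  | succ k ih =>
    intro p q p₀ q₀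
    rw [KK_first, KK_last]
    linear_combination kap a p q * (ih (p+1) (q+1) p₀ q₀ + ih (p+1) (q-1) p₀ q₀ +
      ih (p-1) (q+1) p₀ q₀ + ih (p-1) (q-1) p₀ q₀)

/-- hbx of heights -/
noncomputable def hbx (R : ℕ) : Finset (ℤ × ℤ) := Finset.Icc (-R : ℤ) R ×ˢ Finset.Icc (-R : ℤ) R

lemma card_box (R : ℕ) : ((hbx R).card : ℝ) = (2 * R + 1) ^ 2 := by
  unfold hbx
  rw [Finset.card_product, Int.card_Icc]
  have : ((R : ℤ) + 1 - -R).toNat = 2 * R + 1 := by omega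
  rw [this]; push_cast; ring

lemma TT_iter_box (a : ℝ) (R : ℕ) (g : ℤ → ℤ → ℝ) (k : ℕ) : ∀ p q : ℤ,
    |p| + k ≤ R → |q| + k ≤ R →
    (TT a)^[k] g p q = ∑ z ∈ hbx R, KK a k p q z.1 z.2 * g z.1 z.2 := by
  induction k with
  | zero =>
    intro p q hp hq
    rw [Finset.sum_eq_single (p, q)]
    · simp [KK_zero]
    · rintro ⟨z1, z2⟩ _ hz
      rw [KK_zero, if_neg]
      · simp
      · rintro ⟨h1, h2⟩; exact hz (by simp at h1 h2; rw [h1, h2])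
    · intro h
      exfalso; apply h
      have h1 := abs_le.1 (show |p| ≤ R by simpa using hp)
      have h2 := abs_le.1 (show |q| ≤ R by simpa using hq)
      simp [hbx, h1, h2]
  | succ k ih =>
    intro p q hp hq
    push_cast at hp hq
    have e1 : |p+1| + k ≤ R := by have := abs_add_le p 1; simp at this; linarith
    have e2 : |p-1| + k ≤ R := by have := abs_sub p 1; simp at this; linarith
    have e3 : |q+1| + k ≤ R := by have := abs_add_le q 1; simp at this; linarith
    have e4 : |q-1| + k ≤ R := by have := abs_sub q 1; simp at this; linarith
    rw [Function.iterate_succ_apply']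
    rw [TT_apply, ih _ _ e1 e3, ih _ _ e1 e4, ih _ _ e2 e3, ih _ _ e2 e4]
    simp only [Finset.mul_sum, ← Finset.sum_add_distrib]
    refine Finset.sum_congr rfl fun z _ => ?_
    rw [KK_first]; ring

/-- half weight -/
noncomputable def ww (y : ℝ) : ℤ → ℤ → ℝ := fun p _ => (Real.sqrt y) ^ p

lemma ww_sq {y : ℝ} (hy : 0 < y) (p q : ℤ) : y ^ p = ww y p q * ww y p q := by
  unfold ww
  rw [← mul_zpow, Real.mul_self_sqrt hy.le]

lemma ww_pos {y : ℝ} (hy : 0 < y) (p q : ℤ) : 0 < ww y p q :=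
  zpow_pos (Real.sqrt_pos.2 hy) _

lemma kap_20 (a : ℝ) : kap a 2 0 = a := by simp [kap]
lemma kap_31 (a : ℝ) : kap a 3 1 = 1 := by simp [kap]

lemma KK_start (a : ℝ) (m : ℕ) (p q : ℤ) : KK a (m+1) 1 1 p q = a * KK a m 2 0 p q := by
  rw [KK_first]; norm_num [kap]

lemma eH_even (m : ℕ) : eH (m+1+(m+1)) = 1 := by unfold eH; rw [if_pos (by omega)]
lemma eH_odd (m : ℕ) : eH (m+1+(m+1+1)) = 2 := by unfold eH; rw [if_neg (by omega)]

lemma eH_or (m j : ℕ) (hmj : j = m ∨ j = m + 1) :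
    (eH (m+1+(j+1)) + 1 = 2 ∧ eH (m+1+(j+1)) - 1 = 0) ∨
    (eH (m+1+(j+1)) + 1 = 3 ∧ eH (m+1+(j+1)) - 1 = 1) := by
  rcases hmj with rfl | rfl
  · rw [eH_even]; simp
  · rw [eH_odd]; simp

lemma PG_sum (a y : ℝ) (hy : 0 < y) (m j : ℕ) (hm : 1 ≤ m) (hmj : j = m ∨ j = m + 1) :
    PG (m+1+(j+1)) a y = ∑ z ∈ hbx (m+5), (KK a (m+1) 1 1 z.1 z.2 * ww y z.1 z.2) *
      (KK a j z.1 z.2 (eH (m+1+(j+1)) + 1) (eH (m+1+(j+1)) - 1) * ww y z.1 z.2) := by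
  rw [PG_eq a y m j (by omega) hmj, TT_iter_box a (m+5)]
  · refine Finset.sum_congr rfl fun z _ => ?_
    rw [ww_sq hy z.1 z.2, KK]; ring_nf; rfl
  · push_cast; norm_num; linarith
  · push_cast; norm_num; linarith

lemma PG_lower (a y : ℝ) (ha : 0 < a) (hy : 0 < y) : ∃ c > 0, ∀ m j : ℕ, 1 ≤ m →
    (j = m ∨ j = m + 1) →
    c * ((TT a)^[m] (ww y) 2 0)^2 / (2*m+11)^2 ≤ PG (m+1+(j+1)) a y := by
  have hM : 0 < max 1 a := lt_max_of_lt_left one_pos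
  refine ⟨a^2 / max 1 a, by positivity, fun m j hm hmj => ?_⟩
  rw [PG_sum a y hy m j hm hmj, TT_iter_box a (m+5)]
  rotate_left
  · push_cast; norm_num; linarith
  · push_cast; norm_num
  have cs := sq_sum_le_card_mul_sum_sq (s := hbx (m+5))
    (f := fun z => KK a m 2 0 z.1 z.2 * ww y z.1 z.2)
  rw [card_box] at cs
  push_cast at cs
  have hterm : ∀ z ∈ hbx (m+5), a^2 / max 1 a * (KK a m 2 0 z.1 z.2 * ww y z.1 z.2)^2 ≤
    (KK a (m+1) 1 1 z.1 z.2 * ww y z.1 z.2) *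
      (KK a j z.1 z.2 (eH (m+1+(j+1)) + 1) (eH (m+1+(j+1)) - 1) * ww y z.1 z.2) := by
    intro z _
    have hK := KK_nonneg ha m 2 0 z.1 z.2
    have hw := ww_pos hy z.1 z.2
    rw [KK_start]
    by_cases hz : kap a z.1 z.2 = 0
    · obtain ⟨m', rfl⟩ : ∃ m', m = m' + 1 := ⟨m - 1, by omega⟩
      rw [KK_last, hz]; simp
    · have hz' : 0 < kap a z.1 z.2 := lt_of_le_of_ne (kap_nonneg ha _ _) (Ne.symm hz)
      have h1 : a * KK a m 2 0 z.1 z.2 ≤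
          kap a z.1 z.2 * KK a j z.1 z.2 (eH (m+1+(j+1)) + 1) (eH (m+1+(j+1)) - 1) := by
        rw [KK_rev]
        rcases hmj with rfl | rfl
        · rw [eH_even]; norm_num [kap_20]
        · rw [eH_odd]; norm_num [kap_31]
          rw [KK_first]; norm_num [kap_20]
          have := fun p q => mul_nonneg (kap_nonneg ha p q) (KK_nonneg ha m p q z.1 z.2)
          linarith [this 4 2, this 4 0, this 2 2]
      have h2 : a / max 1 a * KK a m 2 0 z.1 z.2 ≤
          KK a j z.1 z.2 (eH (m+1+(j+1)) + 1) (eH (m+1+(j+1)) - 1) := by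
        have h3 := mul_le_mul_of_nonneg_right (kap_le (a := a) z.1 z.2)
          (KK_nonneg ha j z.1 z.2 (eH (m+1+(j+1)) + 1) (eH (m+1+(j+1)) - 1))
        rw [div_mul_eq_mul_div, div_le_iff₀ hM]
        linarith
      calc _ = (a * KK a m 2 0 z.1 z.2 * ww y z.1 z.2) *
            ((a / max 1 a * KK a m 2 0 z.1 z.2) * ww y z.1 z.2) := by ring
        _ ≤ _ := by gcongr
  have h := Finset.sum_le_sum hterm
  rw [← Finset.mul_sum] at h
  refine le_trans ?_ h
  rw [div_le_iff₀ (by positivity), mul_assoc]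
  refine mul_le_mul_of_nonneg_left ?_ (by positivity)
  refine cs.trans (le_of_eq ?_)
  ring

lemma PG_upper (a y : ℝ) (ha : 0 < a) (hy : 0 < y) : ∃ C > 0, ∀ m j : ℕ, 1 ≤ m →
    (j = m ∨ j = m + 1) →
    PG (m+1+(j+1)) a y ≤ C * ((TT a)^[m+1] (ww y) 1 1 *
      (TT a)^[j] (ww y) (eH (m+1+(j+1)) + 1) (eH (m+1+(j+1)) - 1)) := by
  have hM : 0 < max 1 a := lt_max_of_lt_left one_pos
  have hM' : 0 < min 1 a := lt_min one_pos ha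
  refine ⟨max 1 a / min 1 a, by positivity, fun m j hm hmj => ?_⟩
  rw [PG_sum a y hy m j hm hmj]
  have ho := eH_or m j hmj
  rw [TT_iter_box a (m+5) (ww y) (m+1), TT_iter_box a (m+5) (ww y) j]
  rotate_left
  · rcases ho with ho | ho <;> rw [ho.1] <;> push_cast <;> norm_num <;> omega
  · rcases ho with ho | ho <;> rw [ho.2] <;> push_cast <;> norm_num <;> omega
  · push_cast; norm_num; linarith
  · push_cast; norm_num; linarith
  generalize eH (m+1+(j+1)) + 1 = e1
  generalize eH (m+1+(j+1)) - 1 = e2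
  have hnn : ∀ z ∈ hbx (m+5), 0 ≤ KK a j e1 e2 z.1 z.2 * ww y z.1 z.2 := fun z _ =>
    mul_nonneg (KK_nonneg ha _ _ _ _ _) (ww_pos hy _ _).le
  rw [Finset.sum_mul, Finset.mul_sum]
  refine Finset.sum_le_sum fun z hz => ?_
  have hw := ww_pos hy z.1 z.2
  by_cases hk : kap a z.1 z.2 = 0
  · rw [KK_last, hk]; simp
  · have h1 : KK a j z.1 z.2 e1 e2 ≤ max 1 a / min 1 a * KK a j e1 e2 z.1 z.2 := by
      rw [div_mul_eq_mul_div, le_div_iff₀ hM']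
      have h2 := KK_rev a j z.1 z.2 e1 e2
      have h3 := mul_le_mul_of_nonneg_right (kap_ge z.1 z.2 hk) (KK_nonneg ha j z.1 z.2 e1 e2)
      have h4 := mul_le_mul_of_nonneg_right (kap_le (a := a) e1 e2) (KK_nonneg ha j e1 e2 z.1 z.2)
      linarith
    have h5 := Finset.single_le_sum hnn hz
    have hK := KK_nonneg ha (m+1) 1 1 z.1 z.2
    calc _ ≤ (KK a (m+1) 1 1 z.1 z.2 * ww y z.1 z.2) *
          ((max 1 a / min 1 a * KK a j e1 e2 z.1 z.2) * ww y z.1 z.2) := by gcongr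
      _ = max 1 a / min 1 a * ((KK a (m+1) 1 1 z.1 z.2 * ww y z.1 z.2) *
          (KK a j e1 e2 z.1 z.2 * ww y z.1 z.2)) := by ring
      _ ≤ _ := by gcongr

/-- wall weight -/
noncomputable def wq (a : ℝ) (q : ℤ) : ℝ := if q = 0 then a else 1

/-- growth rate of the lower path -/
noncomputable def lamA (a : ℝ) : ℝ := if a ≤ 2 then 2 else a / Real.sqrt (a-1)

/-- growth rate of the upper path -/
noncomputable def lamB (y : ℝ) : ℝ := if y ≤ 1 then 2 else Real.sqrt y + (Real.sqrt y)⁻¹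

lemma wq_nonneg {a : ℝ} (ha : 0 < a) (q : ℤ) : 0 ≤ wq a q := by
  unfold wq; split_ifs <;> linarith

lemma rfacts (a : ℝ) (ha : 2 < a) : ∃ r : ℝ, 0 < r ∧ r < 1 ∧ lamA a = a * r ∧
    ∀ q : ℤ, r ^ (q+1) + r ^ (q-1) = lamA a * r ^ q := by
  have hs : 1 < Real.sqrt (a-1) := by
    rw [Real.lt_sqrt (by norm_num)]; linarith
  have hs2 := Real.mul_self_sqrt (show 0 ≤ a - 1 by linarith)
  have hlam : lamA a = a / Real.sqrt (a-1) := by unfold lamA; rw [if_neg (by linarith)]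
  set s := Real.sqrt (a-1) with hsdef
  have hs0 : 0 < s := by linarith
  refine ⟨s⁻¹, by positivity, inv_lt_one_of_one_lt₀ hs, hlam, fun q => ?_⟩
  rw [hlam, zpow_add_one₀ (by positivity), zpow_sub_one₀ (by positivity)]
  have : a = s*s+1 := by linarith
  rw [this]
  field_simp
  ring

lemma lamA_ge (a : ℝ) (_ha : 0 < a) : 2 ≤ lamA a := by
  by_cases h : a ≤ 2
  · unfold lamA; rw [if_pos h]
  · unfold lamA; rw [if_neg h]
    have hs2 := Real.mul_self_sqrt (show 0 ≤ a - 1 by linarith)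
    have hs0 : 0 < Real.sqrt (a-1) := Real.sqrt_pos.2 (by linarith)
    rw [le_div_iff₀ hs0]
    nlinarith [sq_nonneg (Real.sqrt (a-1) - 1)]

lemma lamB_ge (y : ℝ) (hy : 0 < y) : 2 ≤ lamB y := by
  unfold lamB
  split_ifs
  · exact le_rfl
  · have hs0 : 0 < Real.sqrt y := Real.sqrt_pos.2 hy
    have : Real.sqrt y + (Real.sqrt y)⁻¹ - 2 = (Real.sqrt y - 1)^2 / Real.sqrt y := by
      field_simp; ring
    have h2 : 0 ≤ (Real.sqrt y - 1)^2 / Real.sqrt y := by positivity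
    linarith

lemma supA (a : ℝ) (ha : 0 < a) (ε : ℝ) (hε : 0 < ε) : ∃ g : ℤ → ℝ, (∀ q, 0 ≤ g q) ∧
    (∀ q < 0, g q = 0) ∧ (∃ c > 0, ∀ q, 0 ≤ q → c ≤ g q) ∧
    ∀ q, 0 ≤ q → wq a (q+1) * g (q+1) + wq a (q-1) * g (q-1) ≤ (lamA a + ε) * g q := by
  by_cases h : a ≤ 2
  · have hl : lamA a = 2 := by unfold lamA; rw [if_pos h]
    have hg : ∀ q : ℤ, 0 ≤ q → wq a q * (if q < 0 then 0 else if q = 0 then 1/a else 1) = 1 := by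
      intro q hq
      rw [if_neg (by omega)]
      unfold wq
      split_ifs
      · field_simp
      · simp
    refine ⟨fun q => if q < 0 then 0 else if q = 0 then 1/a else 1, ?_, ?_, ?_, ?_⟩
    · intro q; dsimp only; split_ifs <;> positivity
    · intro q hq; simp [hq]
    · refine ⟨min 1 (1/a), by positivity, fun q hq => ?_⟩
      dsimp only
      rw [if_neg (by omega)]; split_ifs
      · exact min_le_right _ _
      · exact min_le_left _ _
    · intro q hq
      dsimp only
      rw [hg (q+1) (by omega), hl]
      rcases eq_or_lt_of_le hq with h0 | h0
      · subst h0
        norm_num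
        have : 2 * a⁻¹ ≥ 1 := by
          rw [ge_iff_le, ← div_eq_mul_inv, le_div_iff₀ ha]; linarith
        have : 0 < a⁻¹ := by positivity
        nlinarith
      · rw [hg (q-1) (by omega), if_neg (by omega), if_neg (by omega)]; linarith
  · push Not at h
    obtain ⟨r, hr0, hr1, hl, hr⟩ := rfacts a h
    have hd : 0 < ε / a := by positivity
    set δ := ε / a with hδ
    have hε' : ε = δ * a := by rw [hδ]; field_simp
    have hg : ∀ q : ℤ, 0 ≤ q →
        wq a q * (if q < 0 then 0 else if q = 0 then (1+δ)/a else r^q+δ) = r^q+δ := by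
      intro q hq
      rw [if_neg (by omega)]
      unfold wq
      split_ifs with h0
      · rw [h0]; simp; field_simp
      · simp
    refine ⟨fun q => if q < 0 then 0 else if q = 0 then (1+δ)/a else r^q+δ, ?_, ?_, ?_, ?_⟩
    · intro q; dsimp only; split_ifs <;> positivity
    · intro q hq; simp [hq]
    · refine ⟨δ / a, by positivity, fun q hq => ?_⟩
      dsimp only
      rw [if_neg (by omega)]; split_ifs
      · gcongr; linarith
      · have h1 : δ / a ≤ δ := div_le_self hd.le (by linarith)
        have : 0 < r ^ q := by positivity
        linarith
    · intro q hq
      dsimp only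
      rw [hg (q+1) (by omega)]
      rcases eq_or_lt_of_le hq with h0 | h0
      · subst h0
        norm_num
        have : (lamA a + ε) * ((1+δ)/a) = (r + δ) * (1+δ) := by
          rw [hl, hε']; field_simp
        rw [this]; nlinarith
      · rw [hg (q-1) (by omega), if_neg (by omega), if_neg (by omega)]
        have h1 := hr q
        have h2 := lamA_ge a ha
        have : 0 < r ^ q := by positivity
        nlinarith [mul_pos hε this, mul_pos hε hd]

lemma supB (y : ℝ) (hy : 0 < y) : ∃ g : ℤ → ℝ, (∀ q, 0 ≤ g q) ∧
    (∀ p, 0 ≤ p → (Real.sqrt y)^p ≤ g p) ∧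
    ∀ p, g (p+1) + g (p-1) ≤ lamB y * g p := by
  have hs0 : 0 < Real.sqrt y := Real.sqrt_pos.2 hy
  by_cases h : y ≤ 1
  · refine ⟨fun _ => 1, by simp, ?_, ?_⟩
    · intro p hp
      obtain ⟨n, rfl⟩ := Int.eq_ofNat_of_zero_le hp
      rw [zpow_natCast]
      exact pow_le_one₀ hs0.le (Real.sqrt_le_one.2 h)
    · intro p; unfold lamB; rw [if_pos h]; norm_num
  · refine ⟨fun p => (Real.sqrt y)^p, fun q => by positivity, fun p _ => le_rfl, fun p => ?_⟩
    unfold lamB; rw [if_neg h]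
    dsimp only
    rw [zpow_add_one₀ hs0.ne', zpow_sub_one₀ hs0.ne']
    apply le_of_eq; ring

lemma TTw_upper (a y : ℝ) (ha : 0 < a) (hy : 0 < y) (ε : ℝ) (hε : 0 < ε) (p q : ℤ)
    (hq : 0 ≤ q) (hp : q ≤ p) :
    ∃ C > 0, ∀ k : ℕ, (TT a)^[k] (ww y) p q ≤ C * ((lamA a + ε) * (lamB y + ε))^k := by
  obtain ⟨g1, h1, h2, ⟨c, hc, h3⟩, h4⟩ := supA a ha ε hε
  obtain ⟨g2, h5, h6, h7⟩ := supB y hy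
  have hA := lamA_ge a ha
  have hB := lamB_ge y hy
  set Λ := (lamA a + ε) * (lamB y + ε) with hΛ
  have hΛ0 : 0 ≤ Λ := by positivity
  set G : ℤ → ℤ → ℝ := fun p q => g1 q * g2 p with hG
  have hk : ∀ p q, kap a p q * G p q ≤ wq a q * g1 q * g2 p := by
    intro p q
    have : kap a p q ≤ wq a q := by
      unfold kap
      split_ifs with h8 h9
      · simp [wq, h9]
      · simp [wq, h9]
      · exact wq_nonneg ha q
    have := mul_le_mul_of_nonneg_right this (mul_nonneg (h1 q) (h5 p))
    simp only [hG]; linarith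
  have hT : ∀ p q, 0 ≤ q → q ≤ p → TT a G p q ≤ Λ * G p q := by
    intro p q hq _
    have h8 := h4 q hq
    have h9 : g2 (p+1) + g2 (p-1) ≤ (lamB y + ε) * g2 p := by
      have := h7 p
      have := mul_nonneg hε.le (h5 p)
      linarith
    have h10 : TT a G p q ≤ (wq a (q+1) * g1 (q+1) + wq a (q-1) * g1 (q-1)) *
        (g2 (p+1) + g2 (p-1)) := by
      rw [TT_apply]
      linarith [hk (p+1) (q+1), hk (p+1) (q-1), hk (p-1) (q+1), hk (p-1) (q-1)]
    calc _ ≤ _ := h10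
      _ ≤ ((lamA a + ε) * g1 q) * ((lamB y + ε) * g2 p) := by
        refine mul_le_mul h8 h9 (add_nonneg (h5 _) (h5 _)) ?_
        exact mul_nonneg (by linarith) (h1 q)
      _ = _ := by simp only [hΛ, hG]; ring
  have hTk : ∀ k : ℕ, ∀ p q, 0 ≤ q → q ≤ p → (TT a)^[k] G p q ≤ Λ^k * G p q := by
    intro k
    induction k with
    | zero => intro p q _ _; simp
    | succ k ih =>
      intro p q hq hp
      rw [Function.iterate_succ_apply']
      refine (TT_mono ha ih p q).trans ?_
      rw [TT_smul, pow_succ, mul_assoc]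
      exact mul_le_mul_of_nonneg_left (hT p q hq hp) (by positivity)
  have hGn : 0 ≤ G p q := mul_nonneg (h1 _) (h5 _)
  refine ⟨c⁻¹ * G p q + 1, by positivity, fun k => ?_⟩
  have hw : ∀ p q, 0 ≤ q → q ≤ p → ww y p q ≤ c⁻¹ * G p q := by
    intro p q hq hp
    have h8 := h6 p (by omega)
    have h9 := h3 q hq
    have h10 := mul_le_mul_of_nonneg_right h9 (h5 p)
    rw [← div_eq_inv_mul, le_div_iff₀ hc]
    unfold ww; simp only [hG]
    nlinarith
  have h11 := TT_iter_mono ha hw k p q hq hp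
  rw [TT_iter_smul] at h11
  have h12 := mul_le_mul_of_nonneg_left (hTk k p q hq hp) (inv_nonneg.2 hc.le)
  have h13 : 0 ≤ Λ ^ k := by positivity
  dsimp only at h11
  nlinarith

/-- truncated parabola -/
noncomputable def par (N : ℕ) (q : ℤ) : ℝ := max 0 ((q : ℝ) * (N - q))

lemma par_nonneg (N : ℕ) (q : ℤ) : 0 ≤ par N q := le_max_left _ _

lemma par_zero (N : ℕ) (q : ℤ) (h : q ≤ 0 ∨ (N : ℤ) ≤ q) : par N q = 0 := by
  unfold par
  apply max_eq_left
  rcases h with h | h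
  · have h1 : (q : ℝ) ≤ 0 := by exact_mod_cast h
    have h2 : (0 : ℝ) ≤ N := by positivity
    nlinarith
  · have h1 : (N : ℝ) ≤ q := by exact_mod_cast h
    have h2 : (0 : ℝ) ≤ N := by positivity
    nlinarith

lemma par_pos (N : ℕ) (q : ℤ) (h : 0 < q) (h' : q < N) : 0 < par N q := by
  unfold par
  have h1 : (0 : ℝ) < q := by exact_mod_cast h
  have h2 : (q : ℝ) < N := by exact_mod_cast h'
  exact lt_max_of_lt_right (mul_pos h1 (by linarith))

lemma par_le (N : ℕ) (q : ℤ) : par N q ≤ N^2 := by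
  unfold par
  refine max_le (by positivity) ?_
  nlinarith [sq_nonneg ((N : ℝ) - 2 * q), sq_nonneg (N : ℝ)]

lemma par_sub (N : ℕ) (ε : ℝ) (hN : 2 ≤ ε * (N - 1)) (q : ℤ) (hε : 0 < ε) :
    (2 - ε) * par N q ≤ par N (q+1) + par N (q-1) := by
  by_cases h : q ≤ 0 ∨ (N : ℤ) ≤ q
  · rw [par_zero N q h]; simp; linarith [par_nonneg N (q+1), par_nonneg N (q-1)]
  · push Not at h
    have h1 : (1 : ℝ) ≤ q := by exact_mod_cast h.1
    have h2 : (q : ℝ) + 1 ≤ N := by exact_mod_cast h.2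
    have h3 : par N q = q * (N - q) := max_eq_right (by nlinarith)
    have h4 : ((q : ℝ)+1) * (N - (q+1)) ≤ par N (q+1) := by
      have := le_max_right 0 (((q+1 : ℤ) : ℝ) * (N - ((q+1 : ℤ):ℝ)))
      push_cast at this; unfold par; push_cast; exact this
    have h5 : ((q : ℝ)-1) * (N - (q-1)) ≤ par N (q-1) := by
      have := le_max_right 0 (((q-1 : ℤ) : ℝ) * (N - ((q-1 : ℤ):ℝ)))
      push_cast at this; unfold par; push_cast; exact this
    have h6 : (N : ℝ) - 1 ≤ q * (N - q) := by nlinarith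
    have h7 : ε * (N - 1) ≤ ε * (q * (N - q)) := by gcongr
    rw [h3]; nlinarith

lemma lowA (a : ℝ) (ha : 0 < a) (ε : ℝ) (hε : 0 < ε) (hε1 : ε < 1) : ∃ (H : ℕ) (g : ℤ → ℝ),
    (∀ q, 0 ≤ g q) ∧ (∀ q < 0, g q = 0) ∧ (∀ q : ℤ, (H : ℤ) < q → g q = 0) ∧ 0 < g 1 ∧
    ∀ q, (lamA a - ε) * g q ≤ wq a (q+1) * g (q+1) + wq a (q-1) * g (q-1) := by
  by_cases h : a ≤ 2
  · have hl : lamA a = 2 := by unfold lamA; rw [if_pos h]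
    obtain ⟨N, hN⟩ := exists_nat_gt (2 / ε + 1)
    have hN' : 2 ≤ ε * (N - 1) := by
      have : 2 / ε ≤ N - 1 := by linarith
      rw [div_le_iff₀ hε] at this; linarith
    have hN2 : 1 < N := by
      have : 0 < 2 / ε := by positivity
      have : (1 : ℝ) < N := by linarith
      exact_mod_cast this
    have hw : ∀ q, wq a q * par N q = par N q := by
      intro q
      unfold wq
      split_ifs with h0
      · rw [h0, par_zero N 0 (by simp)]; simp
      · simp
    refine ⟨N, par N, par_nonneg N, fun q hq => par_zero N q (by omega),
      fun q hq => par_zero N q (by omega), par_pos N 1 (by norm_num) (by omega), fun q => ?_⟩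
    rw [hw, hw, hl]
    exact par_sub N ε hN' q hε
  · push Not at h
    obtain ⟨r, hr0, hr1, hl, hr⟩ := rfacts a h
    have hd : 0 < min (ε / a) (r / 2) := by positivity
    have hd1 : min (ε / a) (r / 2) ≤ ε / a := min_le_left _ _
    have hd2 : min (ε / a) (r / 2) ≤ r / 2 := min_le_right _ _
    set δ := min (ε / a) (r / 2) with hδ
    rw [le_div_iff₀ ha] at hd1
    obtain ⟨H, hH⟩ := exists_pow_lt_of_lt_one hd hr1
    have hg : ∀ q : ℤ, 0 ≤ q →
        wq a q * (if q < 0 then 0 else if q = 0 then (1-δ)/a else max 0 (r^q-δ)) =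
          max 0 (r^q-δ) := by
      intro q hq
      rw [if_neg (by omega)]
      unfold wq
      split_ifs with h0
      · rw [h0, max_eq_right]
        · simp; field_simp
        · simp; linarith
      · simp
    have hnn : ∀ q : ℤ, 0 ≤ (if q < 0 then 0 else if q = 0 then (1-δ)/a else max 0 (r^q-δ)) := by
      intro q
      split_ifs
      · exact le_rfl
      · apply div_nonneg <;> linarith
      · exact le_max_left _ _
    refine ⟨H, fun q => if q < 0 then 0 else if q = 0 then (1-δ)/a else max 0 (r^q-δ),
      hnn, ?_, ?_, ?_, ?_⟩
    · intro q hq; simp [hq]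
    · intro q hq
      dsimp only
      rw [if_neg (by omega), if_neg (by omega), max_eq_left]
      obtain ⟨n, rfl⟩ := Int.eq_ofNat_of_zero_le (show 0 ≤ q by omega)
      rw [zpow_natCast]
      have : r ^ n ≤ r ^ H := pow_le_pow_of_le_one hr0.le hr1.le (by omega)
      linarith
    · norm_num; linarith
    · intro q
      have hR : 0 ≤ wq a (q+1) * (if q+1 < 0 then 0 else if q+1 = 0 then (1-δ)/a else max 0 (r^(q+1)-δ)) +
        wq a (q-1) * (if q-1 < 0 then 0 else if q-1 = 0 then (1-δ)/a else max 0 (r^(q-1)-δ)) :=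
        add_nonneg (mul_nonneg (wq_nonneg ha _) (hnn _)) (mul_nonneg (wq_nonneg ha _) (hnn _))
      rcases lt_trichotomy q 0 with h0 | h0 | h0
      · dsimp only
        rw [if_pos h0, mul_zero]; exact hR
      · dsimp only
        rw [hg (q+1) (by omega)]
        subst h0
        norm_num
        right
        have : (lamA a - ε) * ((1-δ)/a) = (r - ε/a) * (1-δ) := by
          rw [hl]; field_simp
        rw [this]
        have h1 : δ ≤ ε / a := min_le_left _ _
        nlinarith
      · dsimp only
        by_cases h1 : r ^ q ≤ δ
        · rw [if_neg (show ¬ q < 0 by omega), if_neg (show ¬ q = 0 by omega),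
            max_eq_left (by linarith : r ^ q - δ ≤ 0), mul_zero]
          exact hR
        · push Not at h1
          rw [hg (q+1) (by omega), hg (q-1) (by omega), if_neg (show ¬ q < 0 by omega),
            if_neg (show ¬ q = 0 by omega), max_eq_right (by linarith : 0 ≤ r ^ q - δ)]
          have h2 := hr q
          have h3 := lamA_ge a ha
          have h4 := le_max_right 0 (r ^ (q+1) - δ)
          have h5 := le_max_right 0 (r ^ (q-1) - δ)
          nlinarith

lemma lowB (y : ℝ) (hy : 0 < y) (ε : ℝ) (hε : 0 < ε) (H : ℕ) : ∃ g : ℤ → ℝ,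
    (∀ p, 0 ≤ g p) ∧ (∀ p : ℤ, p ≤ H → g p = 0) ∧ 0 < g (2*H+3) ∧
    (∃ C > 0, ∀ p, g p ≤ C * (Real.sqrt y)^p) ∧
    ∀ p, (lamB y - ε) * g p ≤ g (p+1) + g (p-1) := by
  have hs0 : 0 < Real.sqrt y := Real.sqrt_pos.2 hy
  by_cases h : y ≤ 1
  · have hl : lamB y = 2 := by unfold lamB; rw [if_pos h]
    have hs1 : Real.sqrt y ≤ 1 := Real.sqrt_le_one.2 h
    obtain ⟨N, hN⟩ := exists_nat_gt (2 / ε + 1 + H + 3)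
    have hH : (0 : ℝ) ≤ H := by positivity
    have hN' : 2 ≤ ε * (N - 1) := by
      have : 2 / ε ≤ N - 1 := by linarith
      rw [div_le_iff₀ hε] at this; linarith
    have hN2 : H + 3 < N := by
      have : 0 < 2 / ε := by positivity
      have : (H : ℝ) + 3 < N := by linarith
      exact_mod_cast this
    refine ⟨fun p => par N (p - H), fun p => par_nonneg _ _, fun p hp => par_zero _ _ (by omega),
      par_pos _ _ (by omega) (by omega), ⟨N^2 / (Real.sqrt y)^(H+N), ?_, ?_⟩, ?_⟩
    · have : (0 : ℝ) < N := by linarith [show 0 < 2/ε by positivity]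
      positivity
    · intro p
      dsimp only
      by_cases hp : p - H ≤ 0 ∨ (N : ℤ) ≤ p - H
      · rw [par_zero _ _ hp]; positivity
      · push Not at hp
        refine (par_le _ _).trans ?_
        rw [div_mul_eq_mul_div, le_div_iff₀ (by positivity)]
        refine mul_le_mul_of_nonneg_left ?_ (by positivity)
        obtain ⟨n, rfl⟩ := Int.eq_ofNat_of_zero_le (show 0 ≤ p by omega)
        rw [zpow_natCast]
        exact pow_le_pow_of_le_one hs0.le hs1 (by omega)
    · intro p
      dsimp only
      rw [hl, show p + 1 - (H : ℤ) = (p - H) + 1 by ring, show p - 1 - (H : ℤ) = (p - H) - 1 by ring]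
      exact par_sub N ε hN' _ hε
  · have hl : lamB y = Real.sqrt y + (Real.sqrt y)⁻¹ := by unfold lamB; rw [if_neg h]
    push Not at h
    have hs1 : 1 < Real.sqrt y := by rw [Real.lt_sqrt (by norm_num)]; linarith
    set s := Real.sqrt y with hs
    have hsne : s ≠ 0 := hs0.ne'
    refine ⟨fun p => max 0 (s^p - s^(2*H-p)), fun p => le_max_left _ _, fun p hp => ?_, ?_,
      ⟨1, one_pos, ?_⟩, ?_⟩
    · apply max_eq_left
      have : s^p ≤ s^(2*H-p) := zpow_le_zpow_right₀ hs1.le (by omega)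
      linarith
    · apply lt_max_of_lt_right
      have : s^(2*H-(2*H+3 : ℤ)) < s^(2*H+3 : ℤ) := zpow_lt_zpow_right₀ hs1 (by omega)
      linarith
    · intro p
      refine max_le (by positivity) ?_
      have : 0 < s^(2*H-p) := by positivity
      linarith
    · intro p
      dsimp only
      have hB := lamB_ge y hy
      have h1 := le_max_left 0 (s^(p+1) - s^(2*H-(p+1)))
      have h2 := le_max_left 0 (s^(p-1) - s^(2*H-(p-1)))
      have h3 := le_max_right 0 (s^(p+1) - s^(2*H-(p+1)))
      have h4 := le_max_right 0 (s^(p-1) - s^(2*H-(p-1)))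
      by_cases h5 : s^p - s^(2*H-p) ≤ 0
      · rw [max_eq_left h5]; linarith
      · push Not at h5
        rw [max_eq_right h5.le]
        have e1 : s^(p+1) = s^p * s := zpow_add_one₀ hsne p
        have e2 : s^(p-1) = s^p * s⁻¹ := zpow_sub_one₀ hsne p
        have e3 : s^(2*H-(p+1)) = s^(2*H-p) * s⁻¹ := by
          rw [← zpow_sub_one₀ hsne]; congr 1; ring
        have e4 : s^(2*H-(p-1)) = s^(2*H-p) * s := by
          rw [← zpow_add_one₀ hsne]; congr 1; ring
        have h6 : (lamB y) * (s^p - s^(2*H-p)) =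
            (s^(p+1) - s^(2*H-(p+1))) + (s^(p-1) - s^(2*H-(p-1))) := by
          rw [e1, e2, e3, e4, hl]; ring
        nlinarith

lemma TT_ge {a : ℝ} (ha : 0 < a) {f : ℤ → ℤ → ℝ} (hf : ∀ p q, 0 ≤ f p q) (p q : ℤ) :
    kap a (p+1) (q+1) * f (p+1) (q+1) ≤ TT a f p q ∧
    kap a (p+1) (q-1) * f (p+1) (q-1) ≤ TT a f p q := by
  have := fun p q => mul_nonneg (kap_nonneg ha p q) (hf p q)
  rw [TT_apply]
  constructor <;>
  linarith [this (p+1) (q+1), this (p+1) (q-1), this (p-1) (q+1), this (p-1) (q-1)]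

lemma start_pos {a : ℝ} (ha : 0 < a) {G : ℤ → ℤ → ℝ} (hG : ∀ p q, 0 ≤ G p q) (H : ℕ) :
    ∀ p : ℤ, 2 ≤ p → 0 < G (p + 2 * H + 1) 1 → 0 < (TT a)^[2*H+1] G p 0 := by
  induction H with
  | zero =>
    intro p hp h
    have h1 := (TT_ge ha hG p 0).1
    simp only [Nat.mul_zero, Nat.zero_add, Function.iterate_one]
    refine lt_of_lt_of_le ?_ h1
    have : kap a (p+1) (0+1) = 1 := by
      unfold kap; rw [if_pos (by omega), if_neg (by omega)]
    rw [this]; simpa using h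
  | succ H ih =>
    intro p hp h
    have h0 := ih (p+2) (by omega) (by convert h using 2; push_cast; ring)
    rw [show 2 * (H+1) + 1 = (2*H+1+1)+1 by ring, Function.iterate_succ_apply',
      Function.iterate_succ_apply']
    have hn := TT_iter_nonneg ha hG (2*H+1)
    have h1 := (TT_ge ha (TT_nonneg ha hn) p 0).1
    have h2 := (TT_ge ha hn (p+1) (0+1)).2
    have k1 : kap a (p+1) (0+1) = 1 := by
      unfold kap; rw [if_pos (by omega), if_neg (by omega)]
    have k2 : kap a (p+1+1) (0+1-1) = a := by
      unfold kap; rw [if_pos (by omega), if_pos (by omega)]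
    rw [k1, one_mul] at h1
    rw [k2] at h2
    refine lt_of_lt_of_le ?_ (h2.trans h1)
    rw [show p + 1 + 1 = p + 2 by ring, show (0:ℤ) + 1 - 1 = 0 by ring]
    positivity

lemma TTw_lower (a y : ℝ) (ha : 0 < a) (hy : 0 < y) (ε : ℝ) (hε : 0 < ε) (hε1 : ε < 1) :
    ∃ c > 0, ∃ k₀ : ℕ, ∀ k : ℕ,
      c * ((lamA a - ε) * (lamB y - ε))^k ≤ (TT a)^[k₀ + k] (ww y) 2 0 := by
  obtain ⟨H, g1, h1, h2, h2', h3, h4⟩ := lowA a ha ε hε hε1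
  obtain ⟨g2, h5, h6, h7, ⟨C, hC, h8⟩, h9⟩ := lowB y hy ε hε H
  have hA := lamA_ge a ha
  have hB := lamB_ge y hy
  set Λ := (lamA a - ε) * (lamB y - ε) with hΛ
  have hΛ0 : 0 ≤ Λ := mul_nonneg (by linarith) (by linarith)
  set G : ℤ → ℤ → ℝ := fun p q => g1 q * g2 p with hG
  have hGn : ∀ p q, 0 ≤ G p q := fun p q => mul_nonneg (h1 _) (h5 _)
  have hk : ∀ p q, kap a p q * G p q = wq a q * g1 q * g2 p := by
    intro p q
    simp only [hG]
    by_cases hq : q < 0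
    · rw [h2 q hq]; simp
    by_cases hqH : (H : ℤ) < q
    · rw [h2' q hqH]; simp
    by_cases hp : p ≤ H
    · rw [h6 p hp]; simp
    · unfold kap wq
      rw [if_pos (by omega)]; ring
  have hT : ∀ p q, Λ * G p q ≤ TT a G p q := by
    intro p q
    have h10 : TT a G p q = (wq a (q+1) * g1 (q+1) + wq a (q-1) * g1 (q-1)) *
        (g2 (p+1) + g2 (p-1)) := by
      rw [TT_apply, hk, hk, hk, hk]; ring
    rw [h10]
    calc _ = ((lamA a - ε) * g1 q) * ((lamB y - ε) * g2 p) := by simp only [hΛ, hG]; ring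
      _ ≤ _ := by
        refine mul_le_mul (h4 q) (h9 p) (mul_nonneg (by linarith) (h5 _)) ?_
        exact add_nonneg (mul_nonneg (wq_nonneg ha _) (h1 _)) (mul_nonneg (wq_nonneg ha _) (h1 _))
  have hTk : ∀ k : ℕ, ∀ p q, Λ^k * G p q ≤ (TT a)^[k] G p q := by
    intro k
    induction k with
    | zero => intro p q; simp
    | succ k ih =>
      intro p q
      rw [Function.iterate_succ_apply']
      refine le_trans ?_ (TT_mono ha (fun p q _ _ => ih p q) p q)
      rw [TT_smul, pow_succ, mul_assoc]
      exact mul_le_mul_of_nonneg_left (hT p q) (by positivity)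
  have hs := start_pos ha hGn H 2 le_rfl (by
    simp only [hG]; rw [show (2 : ℤ) + 2 * H + 1 = 2 * H + 3 by ring]; exact mul_pos h3 h7)
  have hg1 : ∃ M > 0, ∀ q, g1 q ≤ M := by
    refine ⟨1 + ∑ q ∈ Finset.Icc (0:ℤ) H, g1 q, ?_, fun q => ?_⟩
    · have := Finset.sum_nonneg (s := Finset.Icc (0:ℤ) H) (fun q _ => h1 q)
      linarith
    · have h0 := Finset.sum_nonneg (s := Finset.Icc (0:ℤ) H) (fun q _ => h1 q)
      by_cases hq : q ∈ Finset.Icc (0:ℤ) H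
      · have := Finset.single_le_sum (fun q _ => h1 q) hq
        linarith
      · rw [Finset.mem_Icc] at hq
        by_cases hq0 : q < 0
        · rw [h2 q hq0]; linarith
        · rw [h2' q (by omega)]; linarith
  obtain ⟨M, hM, hM'⟩ := hg1
  have hw : ∀ p q, (M * C)⁻¹ * G p q ≤ ww y p q := by
    intro p q
    rw [← div_eq_inv_mul, div_le_iff₀ (by positivity)]
    have h10 : g1 q * g2 p ≤ M * (C * (Real.sqrt y)^p) :=
      mul_le_mul (hM' q) (h8 p) (h5 p) hM.le
    unfold ww; simp only [hG]; linarith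
  refine ⟨(M * C)⁻¹ * (TT a)^[2*H+1] G 2 0, by positivity, 2*H+1, fun k => ?_⟩
  have h11 := TT_iter_mono ha (fun p q _ _ => hw p q) (2*H+1+k) 2 0 le_rfl (by norm_num)
  rw [TT_iter_smul] at h11
  refine le_trans ?_ h11
  dsimp only
  rw [Function.iterate_add_apply (TT a) (2*H+1) k]
  have h12 := TT_iter_mono ha (fun p q _ _ => hTk k p q) (2*H+1) 2 0 le_rfl (by norm_num)
  rw [TT_iter_smul] at h12
  have := mul_le_mul_of_nonneg_left h12 (show 0 ≤ (M * C)⁻¹ by positivity)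
  dsimp only at this
  linarith

lemma split_n (n : ℕ) (hn : 4 ≤ n) : ∃ m j : ℕ, n = m+1+(j+1) ∧ (j = m ∨ j = m + 1) ∧ 1 ≤ m :=
  ⟨n/2 - 1, n - n/2 - 1, by omega, by omega, by omega⟩

lemma PG_lower_n (a y : ℝ) (ha : 0 < a) (hy : 0 < y) (ε : ℝ) (hε : 0 < ε) (hε1 : ε < 1) :
    ∃ c > 0, ∀ᶠ n : ℕ in atTop,
      c * ((lamA a - ε) * (lamB y - ε))^n / ((n : ℝ)+10)^2 ≤ PG n a y := by
  obtain ⟨c, hc, h⟩ := PG_lower a y ha hy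
  obtain ⟨c', hc', k₀, h'⟩ := TTw_lower a y ha hy ε hε hε1
  have hA := lamA_ge a ha
  have hB := lamB_ge y hy
  have hΛ1 : 1 ≤ (lamA a - ε) * (lamB y - ε) :=
    one_le_mul_of_one_le_of_one_le (by linarith) (by linarith)
  set Λ := (lamA a - ε) * (lamB y - ε) with hΛ
  have hΛ0 : 0 < Λ := by linarith
  refine ⟨c * c'^2 / Λ^(2*k₀+3), by positivity, ?_⟩
  filter_upwards [eventually_ge_atTop (2*k₀+5)] with n hn
  obtain ⟨m, j, rfl, hmj, hm⟩ := split_n n (by omega)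
  refine le_trans ?_ (h m j hm hmj)
  obtain ⟨k, rfl⟩ : ∃ k, m = k₀ + k := ⟨m - k₀, by omega⟩
  have h1 := h' k
  have h2 : (c' * Λ^k)^2 ≤ ((TT a)^[k₀ + k] (ww y) 2 0)^2 := by gcongr
  have h3 : Λ^(k₀+k+1+(j+1)) ≤ Λ^(2*k) * Λ^(2*k₀+3) := by
    rw [← pow_add]; exact pow_le_pow_right₀ hΛ1 (by omega)
  have h4 : c * c'^2 / Λ^(2*k₀+3) * Λ^(k₀+k+1+(j+1)) ≤ c * ((TT a)^[k₀ + k] (ww y) 2 0)^2 := by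
    rw [div_mul_eq_mul_div, div_le_iff₀ (by positivity)]
    calc _ ≤ c * c'^2 * (Λ^(2*k) * Λ^(2*k₀+3)) := by gcongr
      _ = c * (c' * Λ^k)^2 * Λ^(2*k₀+3) := by ring
      _ ≤ _ := by gcongr
  have h5 : (2 * ((k₀ + k : ℕ) : ℝ) + 11) ≤ ((k₀+k+1+(j+1) : ℕ) : ℝ) + 10 := by
    have : (2 * (k₀ + k) + 11) ≤ k₀+k+1+(j+1) + 10 := by omega
    exact_mod_cast this
  gcongr

lemma PG_upper_n (a y : ℝ) (ha : 0 < a) (hy : 0 < y) (ε : ℝ) (hε : 0 < ε) :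
    ∃ C > 0, ∀ᶠ n : ℕ in atTop, PG n a y ≤ C * ((lamA a + ε) * (lamB y + ε))^n := by
  obtain ⟨C, hC, h⟩ := PG_upper a y ha hy
  obtain ⟨C1, hC1, h1⟩ := TTw_upper a y ha hy ε hε 1 1 (by norm_num) (by norm_num)
  obtain ⟨C2, hC2, h2⟩ := TTw_upper a y ha hy ε hε 2 0 (by norm_num) (by norm_num)
  obtain ⟨C3, hC3, h3⟩ := TTw_upper a y ha hy ε hε 3 1 (by norm_num) (by norm_num)
  have hA := lamA_ge a ha
  have hB := lamB_ge y hy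
  have hΛ1 : 1 ≤ (lamA a + ε) * (lamB y + ε) :=
    one_le_mul_of_one_le_of_one_le (by linarith) (by linarith)
  set Λ := (lamA a + ε) * (lamB y + ε) with hΛ
  have hΛ0 : 0 < Λ := by linarith
  refine ⟨C * (C1 * (C2 + C3)), by positivity, ?_⟩
  filter_upwards [eventually_ge_atTop 4] with n hn
  obtain ⟨m, j, rfl, hmj, hm⟩ := split_n n hn
  refine (h m j hm hmj).trans ?_
  have h4 : (TT a)^[j] (ww y) (eH (m+1+(j+1)) + 1) (eH (m+1+(j+1)) - 1) ≤ (C2 + C3) * Λ^j := by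
    have : 0 < Λ^j := by positivity
    rcases eH_or m j hmj with ho | ho <;> rw [ho.1, ho.2]
    · have := h2 j; nlinarith
    · have := h3 j; nlinarith
  have h5 := h1 (m+1)
  have h6 := TT_iter_nonneg ha (fun p q => (ww_pos hy p q).le) j
    (eH (m+1+(j+1)) + 1) (eH (m+1+(j+1)) - 1)
  calc _ ≤ C * ((C1 * Λ^(m+1)) * ((C2+C3) * Λ^j)) := by gcongr
    _ = C * (C1 * (C2 + C3)) * Λ^(m+1+j) := by ring
    _ ≤ _ := by
      exact mul_le_mul_of_nonneg_left (pow_le_pow_right₀ hΛ1 (by omega)) (by positivity)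

lemma tendsto_lower_aux (c L : ℝ) :
    Tendsto (fun n : ℕ => (Real.log c + n * L - 2 * Real.log ((n:ℝ)+10)) / (2 * n)) atTop
      (nhds (L / 2)) := by
  have h1 : Tendsto (fun n : ℕ => Real.log c / (n : ℝ)) atTop (nhds 0) :=
    tendsto_const_nhds.div_atTop tendsto_natCast_atTop_atTop
  have h2 : Tendsto (fun n : ℕ => Real.log ((n:ℝ)+10) / (n : ℝ)) atTop (nhds 0) := by
    have h := Real.tendsto_pow_log_div_mul_add_atTop 1 (-10) 1 one_ne_zero
    have h' : Tendsto (fun n : ℕ => (n:ℝ)+10) atTop atTop :=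
      tendsto_atTop_add_const_right _ _ tendsto_natCast_atTop_atTop
    refine (h.comp h').congr fun n => ?_
    simp
  have h3 : Tendsto (fun n : ℕ => (1/2) * (Real.log c / (n : ℝ)) + L / 2
      - Real.log ((n:ℝ)+10) / (n : ℝ)) atTop (nhds ((1/2) * 0 + L / 2 - 0)) :=
    ((h1.const_mul _).add_const _).sub h2
  have e : (1/2 : ℝ) * 0 + L / 2 - 0 = L / 2 := by ring
  rw [e] at h3
  refine h3.congr' ?_
  filter_upwards [eventually_gt_atTop 0] with n hn
  have : (n : ℝ) ≠ 0 := by positivity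
  field_simp

lemma tendsto_upper_aux (c L : ℝ) :
    Tendsto (fun n : ℕ => (Real.log c + n * L) / (2 * n)) atTop (nhds (L / 2)) := by
  have h1 : Tendsto (fun n : ℕ => Real.log c / (n : ℝ)) atTop (nhds 0) :=
    tendsto_const_nhds.div_atTop tendsto_natCast_atTop_atTop
  have h3 : Tendsto (fun n : ℕ => (1/2) * (Real.log c / (n : ℝ)) + L / 2)
      atTop (nhds ((1/2) * 0 + L / 2)) :=
    ((h1.const_mul _).add_const _)
  have e : (1/2 : ℝ) * 0 + L / 2 = L / 2 := by ring
  rw [e] at h3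
  refine h3.congr' ?_
  filter_upwards [eventually_gt_atTop 0] with n hn
  have : (n : ℝ) ≠ 0 := by positivity
  field_simp

lemma main_tendsto (a y : ℝ) (ha : 0 < a) (hy : 0 < y) :
    Tendsto (fun n : ℕ => Real.log (PG n a y) / (2 * n)) atTop
      (nhds (Real.log (lamA a * lamB y) / 2)) := by
  have hA := lamA_ge a ha
  have hB := lamB_ge y hy
  have hpos : ∀ᶠ n : ℕ in atTop, 0 < PG n a y := by
    obtain ⟨c, hc, h⟩ := PG_lower_n a y ha hy (1/2) (by norm_num) (by norm_num)
    filter_upwards [h] with n hn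
    refine lt_of_lt_of_le ?_ hn
    have : 0 < (lamA a - 1/2) * (lamB y - 1/2) := mul_pos (by linarith) (by linarith)
    positivity
  have hcont : Tendsto (fun t : ℝ => Real.log ((lamA a + t) * (lamB y + t)) / 2)
      (nhds 0) (nhds (Real.log (lamA a * lamB y) / 2)) := by
    have : ContinuousAt (fun t : ℝ => Real.log ((lamA a + t) * (lamB y + t)) / 2) 0 := by
      refine ContinuousAt.div_const (ContinuousAt.log (by fun_prop) ?_) _
      simp; constructor <;> linarith
    have h := this.tendsto
    simpa using h
  rw [tendsto_order]
  constructor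
  · intro b hb
    have h1 := hcont.eventually (lt_mem_nhds hb)
    obtain ⟨η, hη, h2⟩ := Metric.eventually_nhds_iff.1 h1
    have he : 0 < min (η/2) (1/2) := by positivity
    set ε := min (η/2) (1/2) with hεd
    have he1 : ε ≤ η/2 := min_le_left _ _
    have he2 : ε ≤ 1/2 := min_le_right _ _
    have h3 := h2 (y := -ε) (by rw [Real.dist_eq, sub_zero, abs_neg, abs_of_pos he]; linarith)
    rw [← sub_eq_add_neg, ← sub_eq_add_neg] at h3
    obtain ⟨c, hc, h⟩ := PG_lower_n a y ha hy ε he (by linarith)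
    have hΛ : 0 < (lamA a - ε) * (lamB y - ε) := mul_pos (by linarith) (by linarith)
    set Λ := (lamA a - ε) * (lamB y - ε)
    filter_upwards [h, (tendsto_lower_aux c (Real.log Λ)).eventually (lt_mem_nhds h3),
      eventually_gt_atTop 0] with n h4 h5 h6
    refine lt_of_lt_of_le h5 ?_
    have h10 : (0:ℝ) < (n:ℝ) + 10 := by positivity
    have h7 := Real.log_le_log (by positivity) h4
    rw [Real.log_div (by positivity) (by positivity), Real.log_mul (by positivity) (by positivity),
      Real.log_pow, Real.log_pow] at h7
    push_cast at h7
    gcongr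
  · intro b hb
    have h1 := hcont.eventually (gt_mem_nhds hb)
    obtain ⟨η, hη, h2⟩ := Metric.eventually_nhds_iff.1 h1
    have h3 := h2 (y := η/2) (by rw [Real.dist_eq, sub_zero, abs_of_pos (by linarith)]; linarith)
    obtain ⟨c, hc, h⟩ := PG_upper_n a y ha hy (η/2) (by linarith)
    have hΛ : 0 < (lamA a + η/2) * (lamB y + η/2) := by positivity
    set Λ := (lamA a + η/2) * (lamB y + η/2)
    filter_upwards [h, (tendsto_upper_aux c (Real.log Λ)).eventually (gt_mem_nhds h3),
      eventually_gt_atTop 0, hpos] with n h4 h5 h6 h7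
    refine lt_of_le_of_lt ?_ h5
    have h8 := Real.log_le_log h7 h4
    rw [Real.log_mul (by positivity) (by positivity), Real.log_pow] at h8
    gcongr

/-- Theorem 1 (`ψ^G`): the free energy of grafted staircase polygons exists and is given
explicitly in the four regions of the `(a,y)`-quarter-plane. -/
theorem psiG_exists (a y : ℝ) (ha : 0 < a) (hy : 0 < y) :
    Tendsto (fun n : ℕ => Real.log (PG n a y) / (2 * n)) atTop
      (nhds (if a ≤ 2 then
          (if y ≤ 1 then Real.log 2
           else (1/2) * Real.log 2 + (1/2) * Real.log (y+1) - (1/4) * Real.log y)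
        else
          (if y ≤ 1 then (1/2) * Real.log 2 + (1/2) * Real.log a - (1/4) * Real.log (a-1)
           else (1/2) * Real.log a - (1/4) * Real.log (a-1)
                + (1/2) * Real.log (y+1) - (1/4) * Real.log y))) := by
  have hA := lamA_ge a ha
  have hB := lamB_ge y hy
  convert main_tendsto a y ha hy using 2
  rw [Real.log_mul (by linarith) (by linarith)]
  have h1 : ¬ a ≤ 2 → Real.log (lamA a) = Real.log a - Real.log (a-1) / 2 := by
    intro h
    have h0 : 0 < a - 1 := by linarith
    unfold lamA
    rw [if_neg h, Real.log_div ha.ne' (Real.sqrt_pos.2 h0).ne', Real.log_sqrt h0.le]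
  have h2 : ¬ y ≤ 1 → Real.log (lamB y) = Real.log (y+1) - Real.log y / 2 := by
    intro h
    have hs := Real.sqrt_pos.2 hy
    have e : Real.sqrt y + (Real.sqrt y)⁻¹ = (y+1) / Real.sqrt y := by
      have := Real.mul_self_sqrt hy.le
      field_simp; linarith
    unfold lamB
    rw [if_neg h, e, Real.log_div (by positivity) hs.ne', Real.log_sqrt hy.le]
  have h3 : a ≤ 2 → Real.log (lamA a) = Real.log 2 := by
    intro h; unfold lamA; rw [if_pos h]
  have h4 : y ≤ 1 → Real.log (lamB y) = Real.log 2 := by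
    intro h; unfold lamB; rw [if_pos h]
  split_ifs with h5 h6 h6
  · rw [h3 h5, h4 h6]; ring
  · rw [h3 h5, h2 h6]; ring
  · rw [h1 h5, h4 h6]; ring
  · rw [h1 h5, h2 h6]; ring
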